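/- arXiv:2412.13809 — 2 statements merged into one kernel-verified Lean document; each statement's English description precedes it below -/
import Mathlib

section
/- Let (T, ≤) be a Weak-Semilattice with least element ⊥, and let T_1, …, T_N be Taxonomy-Aware Tasks for T such that ⊥ ∉ T_i for every i. Then the least element b_i of each T_i is an atom of T, every atom of T equals some b_i, and consequently {T_1, …, T_N} = {up(a) : a is an atom of T}. In particular, any two families of Taxonomy-Aware Tasks avoiding ⊥ are equal as sets of subsets, so the TATs decomposition is unique. -/
/-- `a` is an atom of a poset with least element `bot`: `a ≠ bot` and no
element lies strictly between `bot` and `a`. -/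
def IsAtomOf {T : Type*} [PartialOrder T] (bot a : T) : Prop :=
  a ≠ bot ∧ ∀ x : T, ¬(bot < x ∧ x < a)

/-- `Tasks : Fin N → Set T` is a family of Taxonomy-Aware Tasks for the
Weak-Semilattice `(T, ≤)`. -/
def IsTATFamily {T : Type*} [PartialOrder T] (N : ℕ) (Tasks : Fin N → Set T) : Prop :=
  -- (1) each `(T_i, ≤)` is a Weak-Semilattice
  (∀ i : Fin N, ∀ S' ⊆ Tasks i, ∃ ℓ ∈ Tasks i, ∀ ℓ' ∈ S', ℓ ≤ ℓ') ∧
  -- (2) no strict inclusion between tasks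
  (∀ i j : Fin N, Tasks i ⊆ Tasks j → Tasks i = Tasks j) ∧
  -- (3) each `T_i` is upward closed in `T`
  (∀ i : Fin N, ∀ ℓ ∈ Tasks i, ∀ ℓ' : T, ℓ ≤ ℓ' → ℓ' ∈ Tasks i) ∧
  -- (4) every label outside `low(T)` belongs to some task
  (∀ ℓ : T, ℓ ∉ {m : T | ∀ ℓ' : T, m ≤ ℓ'} → ∃ i : Fin N, ℓ ∈ Tasks i)

theorem tat_aux {T : Type*} [PartialOrder T]
    (bot : T) (hbot : ∀ ℓ : T, bot ≤ ℓ)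
    (N : ℕ) (Tasks : Fin N → Set T)
    (hTAT : IsTATFamily N Tasks)
    (havoid : ∀ i : Fin N, bot ∉ Tasks i) :
    (∀ i : Fin N, ∃ b ∈ Tasks i,
        (∀ ℓ ∈ Tasks i, b ≤ ℓ) ∧ Tasks i = {x : T | b ≤ x} ∧ IsAtomOf bot b) ∧
    (∀ a : T, IsAtomOf bot a → ∃ i : Fin N, Tasks i = {x : T | a ≤ x}) ∧
    ({S : Set T | ∃ i : Fin N, S = Tasks i}
        = {S : Set T | ∃ a : T, IsAtomOf bot a ∧ S = {x : T | a ≤ x}}) := by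
  obtain ⟨h1, h2, h3, h4⟩ := hTAT
  have cover : ∀ x : T, x ≠ bot → ∃ i : Fin N, x ∈ Tasks i := fun x hx =>
    h4 x (fun h => hx (le_antisymm (h bot) (hbot x)))
  have A : ∀ i : Fin N, ∃ b ∈ Tasks i,
      (∀ ℓ ∈ Tasks i, b ≤ ℓ) ∧ Tasks i = {x : T | b ≤ x} ∧ IsAtomOf bot b := by
    intro i
    obtain ⟨b, hb, hle⟩ := h1 i (Tasks i) subset_rfl
    refine ⟨b, hb, hle, Set.ext fun x => ⟨hle x, h3 i b hb x⟩,
      fun h => havoid i (h ▸ hb), ?_⟩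
    rintro x ⟨hx, hxb⟩
    obtain ⟨j, hj⟩ := cover x hx.ne'
    have hsub : Tasks i ⊆ Tasks j := fun y hy =>
      h3 j x hj y (hxb.le.trans (hle y hy))
    have hxi : x ∈ Tasks i := by rw [h2 i j hsub]; exact hj
    exact absurd (hle x hxi) hxb.not_ge
  have B : ∀ a : T, IsAtomOf bot a → ∃ i : Fin N, Tasks i = {x : T | a ≤ x} := by
    intro a ha
    obtain ⟨i, hi⟩ := cover a ha.1
    obtain ⟨b, hb, hle, heq, hat⟩ := A i
    have hba : b = a := by
      by_contra hne
      exact ha.2 b ⟨lt_of_le_of_ne (hbot b) hat.1.symm, lt_of_le_of_ne (hle a hi) hne⟩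
    exact ⟨i, hba ▸ heq⟩
  refine ⟨A, B, Set.ext fun S => ⟨?_, ?_⟩⟩
  · rintro ⟨i, rfl⟩
    obtain ⟨b, _, _, heq, hat⟩ := A i
    exact ⟨b, hat, heq⟩
  · rintro ⟨a, ha, rfl⟩
    obtain ⟨i, hi⟩ := B a ha
    exact ⟨i, hi.symm⟩

/-- In a Weak-Semilattice with least element `⊥`, for any family of
Taxonomy-Aware Tasks avoiding `⊥`: the least element `b_i` of each `T_i` is an
atom, every atom equals some `b_i`, the collection of tasks equals
`{up(a) : a atom}`, and consequently any two TAT families avoiding `⊥` coincide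
as sets of subsets (uniqueness of the TATs decomposition). -/
theorem tats_decomposition_unique {T : Type*} [PartialOrder T]
    (hws : ∀ T' : Set T, ∃ ℓ : T, ∀ ℓ' ∈ T', ℓ ≤ ℓ')
    (bot : T) (hbot : ∀ ℓ : T, bot ≤ ℓ)
    (N : ℕ) (Tasks : Fin N → Set T)
    (hTAT : IsTATFamily N Tasks)
    (havoid : ∀ i : Fin N, bot ∉ Tasks i) :
    (∀ i : Fin N, ∃ b ∈ Tasks i,
        (∀ ℓ ∈ Tasks i, b ≤ ℓ) ∧ Tasks i = {x : T | b ≤ x} ∧ IsAtomOf bot b) ∧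
    (∀ a : T, IsAtomOf bot a → ∃ i : Fin N, Tasks i = {x : T | a ≤ x}) ∧
    ({S : Set T | ∃ i : Fin N, S = Tasks i}
        = {S : Set T | ∃ a : T, IsAtomOf bot a ∧ S = {x : T | a ≤ x}}) ∧
    (∀ (M : ℕ) (Tasks' : Fin M → Set T), IsTATFamily M Tasks' →
        (∀ j : Fin M, bot ∉ Tasks' j) →
        {S : Set T | ∃ i : Fin N, S = Tasks i}
          = {S : Set T | ∃ j : Fin M, S = Tasks' j}) := by
  obtain ⟨hA, hB, hC⟩ := tat_aux bot hbot N Tasks hTAT havoid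
  refine ⟨hA, hB, hC, fun M Tasks' h h' => ?_⟩
  rw [hC, (tat_aux bot hbot M Tasks' h h').2.2]
end

section
/- Let (T, ≤) be a finite Weak-Semilattice with least element ⊥ and at least two elements. Then the collection {up(a) : a is an atom of T} of principal up-sets of the atoms of T is a family of Taxonomy-Aware Tasks for T, none of whose members contains ⊥. (Together with the uniqueness statement, this shows the TATs decomposition exists and is unique for finite taxonomies.) -/
/-- Let `(T, ≤)` be a finite Weak-Semilattice with least element `⊥` and at
least two elements.  Then the collection `{up(a) : a atom of T}` of principal
up-sets of atoms is a family of Taxonomy-Aware Tasks for `T`, none of whose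
members contains `⊥`. -/
theorem tats_decomposition_exists {T : Type*} [PartialOrder T] [Fintype T]
    (bot : T) (hbot : ∀ ℓ : T, bot ≤ ℓ) (hnt : Nontrivial T) :
    ∃ (N : ℕ) (Tasks : Fin N → Set T),
      IsTATFamily N Tasks ∧
      (∀ i : Fin N, bot ∉ Tasks i) ∧
      {S : Set T | ∃ i : Fin N, S = Tasks i}
        = {S : Set T | ∃ a : T, IsAtomOf bot a ∧ S = {x : T | a ≤ x}} := by
  classical
  let e := Finite.equivFin {a : T // IsAtomOf bot a}
  have hlt : ∀ x : T, x ≠ bot → bot < x := fun x hx =>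
    lt_of_le_of_ne (hbot x) (Ne.symm hx)
  refine ⟨_, fun i => {x : T | (e.symm i : T) ≤ x}, ⟨?_, ?_, ?_, ?_⟩, ?_, ?_⟩
  · intro i S' hS'
    exact ⟨(e.symm i : T), le_refl _, fun ℓ' h => hS' h⟩
  · intro i j hij
    have h : (e.symm j : T) ≤ (e.symm i : T) := hij (le_refl (e.symm i : T))
    have heq : (e.symm j : T) = (e.symm i : T) := by
      by_contra hne
      exact (e.symm i).2.2 _ ⟨hlt _ (e.symm j).2.1, lt_of_le_of_ne h hne⟩
    simp only [heq]
  · intro i ℓ hℓ ℓ' h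
    exact le_trans hℓ h
  · intro ℓ hℓ
    have hne : ℓ ≠ bot := by
      rintro rfl
      exact hℓ hbot
    obtain ⟨a, ⟨ha, haℓ⟩, hmin⟩ :=
      (wellFounded_lt (α := T)).has_min {x : T | x ≠ bot ∧ x ≤ ℓ} ⟨ℓ, hne, le_refl ℓ⟩
    have hatom : IsAtomOf bot a :=
      ⟨ha, fun x hx => hmin x ⟨hx.1.ne', hx.2.le.trans haℓ⟩ hx.2⟩
    refine ⟨e ⟨a, hatom⟩, ?_⟩
    simpa using haℓ
  · intro i hi
    exact (e.symm i).2.1 (le_antisymm hi (hbot _))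
  · ext S
    constructor
    · rintro ⟨i, rfl⟩
      exact ⟨_, (e.symm i).2, rfl⟩
    · rintro ⟨a, ha, rfl⟩
      refine ⟨e ⟨a, ha⟩, ?_⟩
      simp
end
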